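/- Let F : ℝ^d → ℝ be L-smooth, let Δ ≥ 0, η = 1/L, and let w_0, w_1, …, w_t be a Δ-inexact gradient descent sequence for F with step size η. Then ‖w_0 − w_t‖ ≤ (2/√L)·√(t·(F(w_0) − F(w_t))) + 2Δ·t/L. -/

import Mathlib

theorem descent_aux {E : Type*} [NormedAddCommGroup E] [InnerProductSpace ℝ E] [CompleteSpace E]
    (F : E → ℝ) (L : ℝ) (hdiff : Differentiable ℝ F)
    (hsmooth : ∀ x y : E, ‖gradient F x - gradient F y‖ ≤ L * ‖x - y‖) (x v : E) :
    F (x + v) ≤ F x + inner ℝ (gradient F x) v + L / 2 * ‖v‖ ^ 2 := by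
  have hd : ∀ s : ℝ, HasDerivAt
      (fun s : ℝ => F (x + s • v) - s * inner ℝ (gradient F x) v - L / 2 * ‖v‖ ^ 2 * s ^ 2)
      (inner ℝ (gradient F (x + s • v)) v - 1 * inner ℝ (gradient F x) v
        - L / 2 * ‖v‖ ^ 2 * (2 * s)) s := by
    intro s
    have h1 : HasDerivAt (fun s : ℝ => x + s • v) v s := by
      simpa using ((hasDerivAt_id s).smul_const v).const_add x
    have h2 := (hdiff (x + s • v)).hasGradientAt.hasFDerivAt.comp_hasDerivAt s h1
    have h3 : HasDerivAt (fun s : ℝ => F (x + s • v)) (inner ℝ (gradient F (x + s • v)) v) s := by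
      exact h2
    have h4 : HasDerivAt (fun s : ℝ => s ^ 2) (2 * s) s := by
      simpa using hasDerivAt_pow 2 s
    exact (h3.sub ((hasDerivAt_id s).mul_const _)).sub (h4.const_mul _)
  have hanti := antitoneOn_of_deriv_nonpos (convex_Icc (0 : ℝ) 1)
    (fun s _ => (hd s).continuousAt.continuousWithinAt)
    (fun s _ => (hd s).differentiableAt.differentiableWithinAt)
    (by
      intro s hs
      rw [interior_Icc] at hs
      rw [(hd s).deriv]
      have h1 := real_inner_le_norm (gradient F (x + s • v) - gradient F x) v
      have h2 := hsmooth (x + s • v) x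
      rw [add_sub_cancel_left, norm_smul, Real.norm_of_nonneg hs.1.le] at h2
      have h3 := mul_le_mul_of_nonneg_right h2 (norm_nonneg v)
      rw [inner_sub_left] at h1
      nlinarith)
  have := hanti (Set.left_mem_Icc.2 zero_le_one) (Set.right_mem_Icc.2 zero_le_one) zero_le_one
  simp only [one_smul, zero_smul, add_zero] at this
  linarith

/-- Along a `Δ`-inexact gradient descent sequence with step size `η = 1/L`
on an `L`-smooth function, the distance moved is controlled by the function decrease. -/
theorem inexact_gd_distance_bound
    (d : ℕ) (F : EuclideanSpace ℝ (Fin d) → ℝ) (L Δ : ℝ)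
    (hL : 0 < L) (hΔ : 0 ≤ Δ)
    (hdiff : Differentiable ℝ F)
    (hsmooth : ∀ x y : EuclideanSpace ℝ (Fin d),
      ‖gradient F x - gradient F y‖ ≤ L * ‖x - y‖)
    (t : ℕ) (w g : ℕ → EuclideanSpace ℝ (Fin d))
    (hseq : ∀ τ < t, ‖g τ - gradient F (w τ)‖ ≤ Δ ∧
      w (τ + 1) = w τ - (1 / L) • g τ) :
    ‖w 0 - w t‖ ≤ 2 / Real.sqrt L * Real.sqrt (t * (F (w 0) - F (w t))) + 2 * Δ * t / L := by
  have hstep : ∀ τ < t, L / 2 * ‖w (τ + 1) - w τ‖ ^ 2 - Δ * ‖w (τ + 1) - w τ‖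
      ≤ F (w τ) - F (w (τ + 1)) := by
    intro τ hτ
    obtain ⟨h1, h2⟩ := hseq τ hτ
    have hD := descent_aux F L hdiff hsmooth (w τ) (w (τ + 1) - w τ)
    rw [add_sub_cancel] at hD
    set s := w (τ + 1) - w τ with hs
    have hg : g τ = -(L • s) := by
      rw [hs, h2, sub_sub_cancel_left, smul_neg, smul_smul, mul_one_div_cancel hL.ne', one_smul,
        neg_neg]
    have h3 := real_inner_le_norm (-(g τ - gradient F (w τ))) s
    rw [norm_neg, neg_sub, inner_sub_left] at h3
    have h4 := mul_le_mul_of_nonneg_right h1 (norm_nonneg s)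
    have h5 : inner ℝ (g τ) s = -(L * ‖s‖ ^ 2) := by
      rw [hg, inner_neg_left, real_inner_smul_left, real_inner_self_eq_norm_sq]
    linarith
  set S := ∑ τ ∈ Finset.range t, ‖w (τ + 1) - w τ‖ with hS
  have hnorm : ‖w 0 - w t‖ ≤ S := by
    rw [norm_sub_rev, ← Finset.sum_range_sub w t]
    exact norm_sum_le _ _
  have hsum := Finset.sum_le_sum (fun τ hτ => hstep τ (Finset.mem_range.1 hτ))
  rw [Finset.sum_range_sub' (fun i => F (w i)), Finset.sum_sub_distrib, ← Finset.mul_sum,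
    ← Finset.mul_sum, ← hS] at hsum
  have hcs := sq_sum_le_card_mul_sum_sq (s := Finset.range t) (f := fun τ => ‖w (τ + 1) - w τ‖)
  rw [Finset.card_range, ← hS] at hcs
  set Q := ∑ τ ∈ Finset.range t, ‖w (τ + 1) - w τ‖ ^ 2
  set D := F (w 0) - F (w t)
  have ht : (0 : ℝ) ≤ t := Nat.cast_nonneg t
  have hS2 : L * S ^ 2 ≤ 2 * (t * D) + 2 * Δ * t * S := by
    have h1 := mul_le_mul_of_nonneg_left hsum ht
    have h2 := mul_le_mul_of_nonneg_left hcs hL.le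
    nlinarith
  refine hnorm.trans ?_
  have hrw : 2 / Real.sqrt L * Real.sqrt (t * D) = 2 * Real.sqrt (t * D / L) := by
    rw [Real.sqrt_div' _ hL.le]; ring
  rw [hrw]
  have hr0 := Real.sqrt_nonneg (t * D / L)
  have hr : t * D / L ≤ Real.sqrt (t * D / L) ^ 2 := by
    rcases le_total 0 (t * D / L) with h | h
    · rw [Real.sq_sqrt h]
    · exact h.trans (sq_nonneg _)
  set r := Real.sqrt (t * D / L)
  have hc : 0 ≤ Δ * t / L := by positivity
  have hq : S ^ 2 ≤ 2 * (t * D / L) + 2 * (Δ * t / L) * S := by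
    have : 2 * (t * D / L) + 2 * (Δ * t / L) * S = (2 * (t * D) + 2 * Δ * t * S) / L := by ring
    rw [this, le_div_iff₀ hL]
    linarith
  have e : 2 * Δ * t / L = 2 * (Δ * t / L) := by ring
  rw [e]
  set c := Δ * t / L
  by_contra! hlt
  have h1 : 0 < S := by linarith
  have h2 : 0 < S - 2 * c - 2 * r := by linarith
  nlinarith [mul_pos h1 h2, mul_nonneg hr0 h2.le, mul_nonneg hr0 hc]
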